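/- Let G be a finite simple graph with ν_G vertices and ε_G edges, and let B_G(t,u) = det[ I − 𝓐(G)·u + (1−t)(𝓓(G) − (1−t)I)·u² ] be the variation of the Bartholdi zeta function of G. Then the partial derivatives of B_G evaluated at the point (t,u) = (0,1) satisfy (∂B_G/∂t)(0,1) = 2(ν_G − ε_G) κ(G) and (∂B_G/∂u)(0,1) = 2(ε_G − ν_G) κ(G). -/

import Mathlib

open scoped Classical
noncomputable section

/-- The finset of spanning trees of a finite simple graph `G`. -/
def spanningTrees {V : Type*} [Fintype V] [DecidableEq V] (G : SimpleGraph V) :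
    Finset (SimpleGraph V) :=
  Finset.univ.filter fun T => T ≤ G ∧ T.IsTree

section Auxiliary

open Finset Matrix

section ParentFunctions

variable {V : Type*}

/-- `f` is the parent function of a tree on `V` rooted at `r`: it fixes `r` and strictly decreases
some depth function elsewhere. -/
def IsParentFunction (r : V) (f : V → V) : Prop :=
  f r = r ∧ ∃ d : V → ℕ, ∀ v, v ≠ r → d (f v) < d v

/-- The graph joining every vertex to its image under `f`. -/
def parentGraph (f : V → V) : SimpleGraph V :=
  SimpleGraph.fromRel fun v w => w = f v

theorem parentGraph_adj {f : V → V} {v w : V} :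
    (parentGraph f).Adj v w ↔ v ≠ w ∧ (w = f v ∨ v = f w) :=
  SimpleGraph.fromRel_adj _ _ _

theorem isParentFunction_of_iterate {r : V} {f : V → V} (hr : f r = r)
    (h : ∀ v, ∃ n, f^[n] v = r) : IsParentFunction r f := by
  refine ⟨hr, fun v => Nat.find (h v), fun v hv => ?_⟩
  have hpos : Nat.find (h v) ≠ 0 := fun h0 => hv (by simpa [h0] using Nat.find_spec (h v))
  obtain ⟨m, hm⟩ := Nat.exists_eq_succ_of_ne_zero hpos
  change Nat.find (h (f v)) < Nat.find (h v)
  rw [hm, Nat.lt_succ_iff]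
  apply Nat.find_min'
  simpa [hm] using Nat.find_spec (h v)

namespace IsParentFunction

variable {r : V} {f g : V → V}

theorem map_ne (hf : IsParentFunction r f) {v : V} (hv : v ≠ r) : f v ≠ v := by
  obtain ⟨-, d, hd⟩ := hf
  intro h
  simpa [h] using hd v hv

theorem map_map_ne (hf : IsParentFunction r f) {v : V} (hv : v ≠ r) : f (f v) ≠ v := by
  intro h
  by_cases hr : f v = r
  · rw [hr, hf.1] at h
    exact hv h.symm
  · obtain ⟨-, d, hd⟩ := hf
    have h1 := hd v hv
    have h2 := hd _ hr
    rw [h] at h2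
    omega

theorem parentGraph_adj_map (hf : IsParentFunction r f) {v : V} (hv : v ≠ r) :
    (parentGraph f).Adj v (f v) :=
  parentGraph_adj.2 ⟨(hf.map_ne hv).symm, Or.inl rfl⟩

theorem reachable (hf : IsParentFunction r f) (v : V) : (parentGraph f).Reachable v r := by
  obtain ⟨d, hd⟩ := hf.2
  induction hn : d v using Nat.strong_induction_on generalizing v with
  | _ n ih =>
    by_cases hv : v = r
    · rw [hv]
    · exact (hf.parentGraph_adj_map hv).reachable.trans (ih _ (hn ▸ hd v hv) _ rfl)

theorem connected (hf : IsParentFunction r f) : (parentGraph f).Connected :=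
  { preconnected := fun v w => (hf.reachable v).trans (hf.reachable w).symm
    nonempty := ⟨r⟩ }

theorem isTree [Fintype V] (hf : IsParentFunction r f) : (parentGraph f).IsTree := by
  refine SimpleGraph.isTree_iff_connected_and_card.2 ⟨hf.connected, ?_⟩
  refine le_antisymm ?_ hf.connected.card_vert_le_card_edgeSet_add_one
  have hsub : (parentGraph f).edgeFinset ⊆ (univ.erase r).image fun v => s(v, f v) := by
    intro e
    induction e using Sym2.ind with
    | _ v w =>
      simp only [SimpleGraph.mem_edgeFinset, SimpleGraph.mem_edgeSet, parentGraph_adj, mem_image,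
        mem_erase, mem_univ, and_true]
      rintro ⟨hne, rfl | rfl⟩
      · exact ⟨v, fun h => hne (by rw [h, hf.1]), rfl⟩
      · exact ⟨w, fun h => hne (by rw [h, hf.1]), Sym2.eq_swap⟩
  have hcard := (card_le_card hsub).trans card_image_le
  rw [card_erase_of_mem (mem_univ r), card_univ] at hcard
  rw [Nat.card_eq_fintype_card, Nat.card_eq_fintype_card, ← SimpleGraph.edgeFinset_card]
  have : 0 < Fintype.card V := Fintype.card_pos_iff.2 ⟨r⟩
  omega

theorem eq_of_parentGraph_eq (hf : IsParentFunction r f) (hg : IsParentFunction r g)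
    (h : parentGraph f = parentGraph g) : f = g := by
  obtain ⟨d, hd⟩ := hf.2
  have key : ∀ v, v ≠ r → f v = g v := by
    intro v
    induction hn : d v using Nat.strong_induction_on generalizing v with
    | _ n ih =>
      intro hv
      by_contra hne
      have hadj := hf.parentGraph_adj_map hv
      rw [h, parentGraph_adj] at hadj
      obtain hadj | hadj := hadj.2
      · exact hne hadj
      · by_cases hr : f v = r
        · rw [hr, hg.1] at hadj
          exact hv hadj
        · refine hf.map_map_ne hv ?_
          rw [ih _ (hn ▸ hd v hv) _ rfl hr, ← hadj]
  funext v
  by_cases hv : v = r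
  · rw [hv, hf.1, hg.1]
  · exact key v hv

end IsParentFunction

theorem SimpleGraph.Connected.exists_adj_dist_lt {T : SimpleGraph V} (hT : T.Connected)
    {v r : V} (hv : v ≠ r) : ∃ w, T.Adj v w ∧ T.dist w r < T.dist v r := by
  obtain ⟨p, hp⟩ := hT.exists_walk_length_eq_dist v r
  cases p with
  | nil => exact absurd rfl hv
  | cons hadj q =>
    refine ⟨_, hadj, ?_⟩
    rw [← hp, SimpleGraph.Walk.length_cons, Nat.lt_succ_iff]
    exact SimpleGraph.dist_le q

theorem SimpleGraph.IsTree.exists_parentGraph_eq [Fintype V] {T : SimpleGraph V} (hT : T.IsTree)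
    (r : V) : ∃ f, IsParentFunction r f ∧ parentGraph f = T := by
  choose! p hp using fun v (hv : v ≠ r) => hT.connected.exists_adj_dist_lt hv
  have hf : IsParentFunction r (fun v => if v = r then r else p v) := by
    refine ⟨if_pos rfl, fun v => T.dist v r, fun v hv => ?_⟩
    simpa [hv] using (hp v hv).2
  refine ⟨_, hf, (SimpleGraph.isTree_iff_minimal_connected.1 hT).eq_of_le hf.connected ?_⟩
  intro v w hvw
  obtain ⟨hne, h | h⟩ := parentGraph_adj.1 hvw
  · have hv : v ≠ r := by rintro rfl; simp_all
    simpa [h, hv] using (hp v hv).1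
  · have hw : w ≠ r := by rintro rfl; simp_all
    simpa [h, hw] using (hp w hw).1.symm

theorem card_spanningTrees_eq_card_parentFunctions [Fintype V] [DecidableEq V]
    (G : SimpleGraph V) (r : V) :
    #(spanningTrees G) =
      #{f : V → V | (∀ v, v ≠ r → G.Adj v (f v)) ∧ IsParentFunction r f} := by
  symm
  refine card_nbij parentGraph ?_ ?_ ?_
  · intro f hf
    obtain ⟨hG, hf⟩ := (mem_filter.1 hf).2
    refine mem_filter.2 ⟨mem_univ _, ?_, hf.isTree⟩
    intro v w hvw
    obtain ⟨hne, rfl | rfl⟩ := parentGraph_adj.1 hvw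
    · exact hG v fun h => hne (by rw [h, hf.1])
    · exact (hG w fun h => hne (by rw [h, hf.1])).symm
  · intro f hf g hg h
    simp only [coe_filter, mem_univ, true_and, Set.mem_ofPred_eq] at hf hg
    exact hf.2.eq_of_parentGraph_eq hg.2 h
  · intro T hT
    obtain ⟨hle, hT⟩ := (mem_filter.1 hT).2
    obtain ⟨f, hf, rfl⟩ := hT.exists_parentGraph_eq r
    refine ⟨f, ?_, rfl⟩
    simp only [coe_filter, mem_univ, true_and, Set.mem_ofPred_eq]
    exact ⟨fun v hv => hle (hf.parentGraph_adj_map hv), hf⟩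

end ParentFunctions

section MatrixTree

variable {V : Type*} [Fintype V] [DecidableEq V]

/-- The Laplacian of the directed graph `v ↦ f v`, with the row of the root `r` replaced by the
corresponding unit vector. -/
def parentMatrix (r : V) (f : V → V) : Matrix V V ℝ :=
  fun v => if v = r then Pi.single r 1 else Pi.single v 1 - Pi.single (f v) 1

theorem det_parentMatrix_of_isParentFunction {r : V} {f : V → V} (hf : IsParentFunction r f) :
    (parentMatrix r f).det = 1 := by
  obtain ⟨d, hd⟩ := hf.2
  have htri : (parentMatrix r f).BlockTriangular (OrderDual.toDual ∘ d) := by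
    intro i j hij
    have hij : d i < d j := hij
    have hne : j ≠ i := by rintro rfl; exact lt_irrefl _ hij
    by_cases hi : i = r
    · subst hi
      simp [parentMatrix, hne]
    · have hne' : j ≠ f i := by rintro rfl; exact lt_asymm hij (hd i hi)
      simp [parentMatrix, hi, hne, hne']
  rw [htri.det]
  refine prod_eq_one fun k _ => ?_
  rw [← Matrix.det_one (R := ℝ) (n := {v // (OrderDual.toDual ∘ d) v = k})]
  congr 1
  ext ⟨i, hi⟩ ⟨j, hj⟩
  have hij : d i = d j := OrderDual.toDual.injective (hi.trans hj.symm)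
  by_cases hir : i = r
  · subst hir
    simp [parentMatrix, toSquareBlock_def, Pi.single_apply, Matrix.one_apply, eq_comm]
  · have hne : j ≠ f i := by rintro rfl; exact (hd i hir).ne hij.symm
    simp [parentMatrix, toSquareBlock_def, Pi.single_apply, Matrix.one_apply, hir, hne,
      eq_comm (a := i)]

theorem det_parentMatrix_of_not_isParentFunction {r : V} {f : V → V} (hr : f r = r)
    (hf : ¬ IsParentFunction r f) : (parentMatrix r f).det = 0 := by
  obtain ⟨v, hv⟩ : ∃ v, ∀ n, f^[n] v ≠ r := by
    by_contra! h
    exact hf (isParentFunction_of_iterate hr h)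
  have hmap : ∀ w, (∀ n, f^[n] (f w) ≠ r) ↔ ∀ n, f^[n] w ≠ r := by
    refine fun w => ⟨fun h n hn => h n ?_, fun h n => h (n + 1)⟩
    rw [← Function.iterate_succ_apply, Function.iterate_succ_apply', hn, hr]
  refine Matrix.exists_mulVec_eq_zero_iff.1 ⟨fun w => if ∀ n, f^[n] w ≠ r then 1 else 0, ?_, ?_⟩
  · intro h
    simpa [hv] using congrFun h v
  · funext w
    by_cases hw : w = r
    · have h0 : ¬ ∀ n, f^[n] r ≠ r := fun h => h 0 rfl
      simp only [hw, Matrix.mulVec, parentMatrix, if_true, single_one_dotProduct, if_neg h0,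
        Pi.zero_apply]
    · simp only [hw, Matrix.mulVec, parentMatrix, if_false, sub_dotProduct, single_one_dotProduct,
        hmap, sub_self, Pi.zero_apply]

theorem updateRow_lapMatrix_eq_sum (G : SimpleGraph V) [DecidableRel G.Adj] (r : V) :
    (G.lapMatrix ℝ).updateRow r (Pi.single r 1) = fun v =>
      ∑ w ∈ if v = r then {r} else G.neighborFinset v,
        if v = r then Pi.single r 1 else Pi.single v 1 - Pi.single w (1 : ℝ) := by
  funext v
  by_cases hv : v = r
  · subst hv
    simp
  · ext w
    simp [hv, SimpleGraph.lapMatrix, SimpleGraph.degMatrix, Matrix.diagonal_apply,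
      Pi.single_apply, Finset.sum_apply, eq_comm, SimpleGraph.adjMatrix_apply]

theorem det_updateRow_lapMatrix_self (G : SimpleGraph V) [DecidableRel G.Adj] (r : V) :
    ((G.lapMatrix ℝ).updateRow r (Pi.single r 1)).det = #(spanningTrees G) := by
  rw [updateRow_lapMatrix_eq_sum, card_spanningTrees_eq_card_parentFunctions G r]
  have hsum := (Matrix.detRowAlternating (R := ℝ) (n := V)).toMultilinearMap.map_sum_finset
    (fun v w => if v = r then Pi.single r 1 else Pi.single v 1 - Pi.single w (1 : ℝ))
    (fun v => if v = r then {r} else G.neighborFinset v)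
  refine hsum.trans ?_
  have hdet : ∀ f ∈ Fintype.piFinset (fun v => if v = r then {r} else G.neighborFinset v),
      (parentMatrix r f).det = if IsParentFunction r f then 1 else 0 := by
    intro f hf
    split_ifs with h
    · exact det_parentMatrix_of_isParentFunction h
    · refine det_parentMatrix_of_not_isParentFunction ?_ h
      simpa using Fintype.mem_piFinset.1 hf r
  refine (sum_congr rfl hdet).trans ?_
  rw [sum_boole]
  congr 2
  ext f
  simp only [mem_filter, Fintype.mem_piFinset, mem_univ, true_and]
  refine and_congr_left fun hf => forall_congr' fun v => ?_
  by_cases hv : v = r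
  · simp [hv, hf.1]
  · simp [hv]

/-- Every cofactor of the Laplacian matrix counts the spanning trees. -/
theorem adjugate_lapMatrix (G : SimpleGraph V) [DecidableRel G.Adj] (i r : V) :
    (G.lapMatrix ℝ).adjugate i r = #(spanningTrees G) := by
  rw [Matrix.adjugate_apply, ← det_updateRow_lapMatrix_self G r, ← sub_eq_zero]
  have hsub := (Matrix.detRowAlternating (R := ℝ) (n := V)).map_update_sub (G.lapMatrix ℝ) r
    (Pi.single i 1) (Pi.single r 1)
  refine hsub.symm.trans ?_
  refine Matrix.exists_mulVec_eq_zero_iff.1 ⟨fun _ => 1, fun h => one_ne_zero (congrFun h r), ?_⟩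
  funext v
  by_cases hv : v = r
  · subst hv
    change (G.lapMatrix ℝ).updateRow v (Pi.single i 1 - Pi.single v 1) v ⬝ᵥ _ = 0
    rw [Matrix.updateRow_self]
    simp [dotProduct]
  · change (G.lapMatrix ℝ).updateRow r (Pi.single i 1 - Pi.single r 1) v ⬝ᵥ _ = 0
    rw [Matrix.updateRow_ne hv]
    exact congrFun (G.lapMatrix_mulVec_const_eq_zero (R := ℝ)) v

end MatrixTree

theorem hasDerivAt_det {V : Type*} [Fintype V] [DecidableEq V] {M : ℝ → Matrix V V ℝ}
    {M' : Matrix V V ℝ} {x : ℝ} (hM : ∀ i j, HasDerivAt (fun t => M t i j) (M' i j) x) :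
    HasDerivAt (fun t => (M t).det) (∑ i, ∑ j, M' i j * (M x).adjugate j i) x := by
  let D : ContinuousMultilinearMap ℝ (fun _ : V => V → ℝ) ℝ :=
    { (Matrix.detRowAlternating (R := ℝ) (n := V)).toMultilinearMap with
      cont := Continuous.matrix_det continuous_id }
  have hrows : HasDerivAt (fun t i => M t i) (fun i => M' i) x :=
    hasDerivAt_pi.2 fun i => hasDerivAt_pi.2 fun j => hM i j
  have hD := (D.hasFDerivAt (fun i => M x i)).comp_hasDerivAt x hrows
  refine hD.congr_deriv ?_
  rw [ContinuousMultilinearMap.linearDeriv_apply]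
  refine sum_congr rfl fun i _ => ?_
  change ((M x).updateRow i (M' i)).det = _
  rw [← Matrix.cramer_transpose_apply, Matrix.cramer_eq_adjugate_mulVec]
  simp [Matrix.mulVec, dotProduct, ← Matrix.adjugate_transpose, mul_comm]

theorem hasDerivAt_det_of_eq_lapMatrix {V : Type*} [Fintype V] [DecidableEq V]
    (G : SimpleGraph V) [DecidableRel G.Adj] {M : ℝ → Matrix V V ℝ} {M' : Matrix V V ℝ} {x : ℝ}
    (hx : M x = G.lapMatrix ℝ) (hM : ∀ i j, HasDerivAt (fun t => M t i j) (M' i j) x) :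
    HasDerivAt (fun t => (M t).det) ((∑ i, ∑ j, M' i j) * #(spanningTrees G)) x := by
  refine (hasDerivAt_det hM).congr_deriv ?_
  simp_rw [hx, adjugate_lapMatrix, sum_mul]

theorem sum_sum_adjMatrix {V : Type*} [Fintype V] [DecidableEq V] (G : SimpleGraph V)
    [DecidableRel G.Adj] : ∑ i, ∑ j, G.adjMatrix ℝ i j = 2 * #G.edgeFinset := by
  have h := congrArg (Nat.cast (R := ℝ)) G.sum_degrees_eq_twice_card_edges
  push_cast at h
  rw [← h]
  exact sum_congr rfl fun i _ => by
    simp [SimpleGraph.degree_eq_sum_if_adj, SimpleGraph.adjMatrix_apply]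

theorem sum_sum_diagonal_degree {V : Type*} [Fintype V] [DecidableEq V] (G : SimpleGraph V)
    [DecidableRel G.Adj] :
    ∑ i, ∑ j, Matrix.diagonal (fun i => (G.degree i : ℝ)) i j = 2 * #G.edgeFinset := by
  have h := congrArg (Nat.cast (R := ℝ)) G.sum_degrees_eq_twice_card_edges
  push_cast at h
  rw [← h]
  exact sum_congr rfl fun i _ => by simp [Matrix.diagonal_apply]

theorem sum_sum_one {V : Type*} [Fintype V] [DecidableEq V] :
    ∑ i, ∑ j, (1 : Matrix V V ℝ) i j = Fintype.card V := by
  simp [Matrix.one_apply]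

end Auxiliary

/-- Theorem (`Barthcoro`): for a finite simple graph `G` with `ν_G` vertices and `ε_G` edges,
the variation of the Bartholdi zeta function
`B_G(t,u) = det(I - 𝓐(G)·u + (1-t)(𝓓(G) - (1-t)I)·u²)` satisfies, at `(t,u) = (0,1)`,
`∂B_G/∂t (0,1) = 2(ν_G - ε_G)·κ(G)` and `∂B_G/∂u (0,1) = 2(ε_G - ν_G)·κ(G)`,
where `κ(G)` is the number of spanning trees of `G`. -/
theorem partial_bartholdi_variation_eq {V : Type*} [Fintype V] [DecidableEq V]
    (G : SimpleGraph V) [DecidableRel G.Adj] :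
    HasDerivAt
      (fun t : ℝ =>
        ((1 : Matrix V V ℝ) - (1 : ℝ) • G.adjMatrix ℝ +
          ((1 - t) * 1 ^ 2) •
            (Matrix.diagonal (fun i => (G.degree i : ℝ)) - (1 - t) • 1)).det)
      (2 * ((Fintype.card V : ℝ) - (G.edgeFinset.card : ℝ)) * ((spanningTrees G).card : ℝ))
      0 ∧
    HasDerivAt
      (fun u : ℝ =>
        ((1 : Matrix V V ℝ) - u • G.adjMatrix ℝ +
          ((1 - 0) * u ^ 2) •
            (Matrix.diagonal (fun i => (G.degree i : ℝ)) - (1 - (0 : ℝ)) • 1)).det)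
      (2 * ((G.edgeFinset.card : ℝ) - (Fintype.card V : ℝ)) * ((spanningTrees G).card : ℝ))
      1 := by
  set A := G.adjMatrix ℝ
  set D := Matrix.diagonal (fun i => (G.degree i : ℝ))
  have hL : G.lapMatrix ℝ = D - A := rfl
  have hsA : ∑ i, ∑ j, A i j = 2 * G.edgeFinset.card := sum_sum_adjMatrix G
  have hsD : ∑ i, ∑ j, D i j = 2 * G.edgeFinset.card := sum_sum_diagonal_degree G
  constructor
  · refine (hasDerivAt_det_of_eq_lapMatrix G (M' := (2 : ℝ) • 1 - D) ?_
      fun i j => ?_).congr_deriv ?_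
    · rw [hL]
      simp
    · simp only [Matrix.add_apply, Matrix.sub_apply, Matrix.smul_apply, smul_eq_mul]
      have h1 : HasDerivAt (fun t : ℝ => 1 - t) (-1) 0 := (hasDerivAt_id' (0 : ℝ)).const_sub 1
      refine (((h1.mul_const (1 ^ 2)).mul
        ((h1.mul_const ((1 : Matrix V V ℝ) i j)).const_sub (D i j))).const_add
        ((1 : Matrix V V ℝ) i j - 1 * A i j)).congr_deriv ?_
      ring
    · simp only [Matrix.sub_apply, Matrix.smul_apply, smul_eq_mul, Finset.sum_sub_distrib,
        ← Finset.mul_sum, hsD, sum_sum_one]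
      ring
  · refine (hasDerivAt_det_of_eq_lapMatrix G (M' := (2 : ℝ) • (D - 1) - A) ?_
      fun i j => ?_).congr_deriv ?_
    · rw [hL]
      simp
    · simp only [Matrix.add_apply, Matrix.sub_apply, Matrix.smul_apply, smul_eq_mul]
      have h1 := hasDerivAt_id' (1 : ℝ)
      refine (((h1.mul_const (A i j)).const_sub ((1 : Matrix V V ℝ) i j)).add
        (((h1.pow 2).const_mul (1 - 0)).mul_const
          (D i j - (1 - 0) * (1 : Matrix V V ℝ) i j))).congr_deriv ?_
      norm_num
      ring
    · simp only [Matrix.sub_apply, Matrix.smul_apply, smul_eq_mul, Finset.sum_sub_distrib,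
        ← Finset.mul_sum, hsA, hsD, sum_sum_one]
      ring
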